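/- Let G be a group and let X and Y be reduced cocompact G-trees, with X strongly slide-free. If φ : X → Y is a coarsely equivariant quasi-isometry, then there is a unique equivariant isometry from X to Y, and it lies at finite distance from φ (i.e., sup over x of the distance between its value and φ(x) is finite). -/

import Mathlib

universe u

/-- A `G`-tree: a simplicial tree together with an action of `G` by graph
automorphisms without inversions. -/
structure GTree (G : Type u) [Group G] : Type (u + 1) where
  V : Type u
  graph : SimpleGraph V
  isTree : graph.IsTree
  smul : G → V → V
  smul_one : ∀ x, smul 1 x = x
  smul_mul : ∀ γ δ x, smul (γ * δ) x = smul γ (smul δ x)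
  smul_adj : ∀ (γ : G) ⦃x y : V⦄, graph.Adj x y → graph.Adj (smul γ x) (smul γ y)
  no_inversions : ∀ (γ : G) (x y : V), graph.Adj x y → ¬(smul γ x = y ∧ smul γ y = x)

namespace GTree

variable {G : Type u} [Group G]

/-- Oriented edges of a `G`-tree. -/
def Edge (X : GTree G) : Type u := { p : X.V × X.V // X.graph.Adj p.1 p.2 }

/-- Initial vertex `∂₀ e` of an oriented edge. -/
def d0 {X : GTree G} (e : X.Edge) : X.V := e.1.1

/-- Terminal vertex `∂₁ e` of an oriented edge. -/
def d1 {X : GTree G} (e : X.Edge) : X.V := e.1.2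

/-- The underlying geometric (unoriented) edge. -/
def esym {X : GTree G} (e : X.Edge) : Sym2 X.V := s(e.1.1, e.1.2)

/-- Action of `G` on oriented edges. -/
def edgeSmul {X : GTree G} (γ : G) (e : X.Edge) : X.Edge :=
  ⟨(X.smul γ e.1.1, X.smul γ e.1.2), X.smul_adj γ e.2⟩

/-- Vertex stabilizer `G_x`. -/
def stab (X : GTree G) (x : X.V) : Subgroup G where
  carrier := { γ | X.smul γ x = x }
  one_mem' := X.smul_one x
  mul_mem' := by
    intro a b ha hb
    simp only [Set.mem_setOf_eq] at *
    rw [X.smul_mul, hb, ha]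
  inv_mem' := by
    intro a ha
    simp only [Set.mem_setOf_eq] at *
    conv_lhs => rw [← ha]
    rw [← X.smul_mul, inv_mul_cancel, X.smul_one]

/-- Edge stabilizer `G_e`: the elements fixing both endpoints (since the action
is without inversions, these are exactly the elements fixing the edge). -/
def edgeStab (X : GTree G) (e : X.Edge) : Subgroup G :=
  X.stab (d0 e) ⊓ X.stab (d1 e)

/-- An element of `G` is elliptic if it fixes a vertex. -/
def Elliptic (X : GTree G) (γ : G) : Prop := ∃ x, X.smul γ x = x

/-- A subgroup of `G` is elliptic if it fixes a vertex. -/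
def FixesVertex (X : GTree G) (H : Subgroup G) : Prop := ∃ x, ∀ γ ∈ H, X.smul γ x = x

/-- Two `G`-trees have the same elliptic subgroups. -/
def SameEllipticSubgroups (X Y : GTree G) : Prop :=
  ∀ H : Subgroup G, X.FixesVertex H ↔ Y.FixesVertex H

/-- The length function `ℓ_X(γ)`: the minimal vertex displacement. -/
noncomputable def transLen (X : GTree G) (γ : G) : ℕ :=
  sInf (Set.range fun x => X.graph.dist x (X.smul γ x))

/-- Cocompact: the quotient graph `G\X` is finite, i.e. there are finitely
many orbits of vertices and of edges. -/
def Cocompact (X : GTree G) : Prop :=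
  Finite (Quot fun x y : X.V => ∃ γ, X.smul γ x = y) ∧
    Finite (Quot fun e f : X.Edge => ∃ γ, edgeSmul γ e = f)

/-- Reduced: whenever `G_e = G_{∂₀ e}`, the endpoints of `e` are in the same
`G`-orbit. -/
def Reduced (X : GTree G) : Prop :=
  ∀ e : X.Edge, X.edgeStab e = X.stab (d0 e) → ∃ γ, X.smul γ (d0 e) = d1 e

/-- A nonempty `G`-invariant subtree (a nonempty invariant set of vertices that
is connected in the induced graph). -/
def IsInvariantSubtree (X : GTree G) (S : Set X.V) : Prop :=
  S.Nonempty ∧ (∀ γ, ∀ x ∈ S, X.smul γ x ∈ S) ∧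
    ∀ x ∈ S, ∀ y ∈ S, ∃ p : X.graph.Walk x y, ∀ v ∈ p.support, v ∈ S

/-- Minimal: there is no proper nonempty invariant subtree. -/
def Minimal (X : GTree G) : Prop :=
  ∀ S : Set X.V, X.IsInvariantSubtree S → S = Set.univ

/-- Strongly slide-free: minimal, and for all edges `e`, `f` with
`∂₀ e = ∂₀ f`, the inclusion `G_e ⊆ G_f` implies `f ∈ G e`. -/
def StronglySlideFree (X : GTree G) : Prop :=
  X.Minimal ∧ ∀ e f : X.Edge, d0 e = d0 f → X.edgeStab e ≤ X.edgeStab f →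
    ∃ γ, edgeSmul γ e = f

/-- Proper: `G_e ⊊ G_{∂₀ e}` for every edge `e`. -/
def Proper (X : GTree G) : Prop := ∀ e : X.Edge, X.edgeStab e < X.stab (d0 e)

/-- Locally finite: every vertex has finite valence. -/
def LocallyFinite (X : GTree G) : Prop := ∀ x : X.V, (X.graph.neighborSet x).Finite

/-- `φ` is an isomorphism of `G`-trees: an equivariant graph isomorphism. -/
def IsGIso (X Y : GTree G) (φ : X.V → Y.V) : Prop :=
  Function.Bijective φ ∧ (∀ x y, X.graph.Adj x y ↔ Y.graph.Adj (φ x) (φ y)) ∧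
    ∀ γ x, φ (X.smul γ x) = Y.smul γ (φ x)

/-- `φ : X → Y` is the collapse move performed at (the orbit of) the edge `e`:
`G_e = G_{∂₀ e}`, the endpoints of `e` lie in different `G`-orbits, and `Y` is
the equivariant quotient of `X` identifying `∂₀(γ e)` with `∂₁(γ e)` for all
`γ ∈ G`. -/
def IsCollapse (X Y : GTree G) (φ : X.V → Y.V) (e : X.Edge) : Prop :=
  X.edgeStab e = X.stab (d0 e) ∧
  (∀ γ : G, X.smul γ (d0 e) ≠ d1 e) ∧
  Function.Surjective φ ∧
  (∀ γ x, φ (X.smul γ x) = Y.smul γ (φ x)) ∧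
  (∀ u v : X.V, φ u = φ v ↔
    Relation.EqvGen (fun a b => ∃ γ : G, a = X.smul γ (d0 e) ∧ b = X.smul γ (d1 e)) u v) ∧
  (∀ a b : Y.V, a ≠ b → (Y.graph.Adj a b ↔ ∃ u v, X.graph.Adj u v ∧ φ u = a ∧ φ v = b))

/-- `Y` is obtained from `X` by a collapse move. -/
def Collapse (X Y : GTree G) : Prop := ∃ (φ : X.V → Y.V) (e : X.Edge), IsCollapse X Y φ e

/-- Elementary deformation: a finite composition of collapse moves and their
inverses (expansion moves). -/
def ElemDeformation : GTree G → GTree G → Prop := Relation.EqvGen Collapse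

end GTree

namespace GTree

variable {G : Type u} [Group G]

/-- `f : X → Y` is a quasi-isometry of the vertex sets (with the path
metrics): there are `K ≥ 1`, `C ≥ 0` with
`K⁻¹ d(x,x') − C ≤ d(f x, f x') ≤ K d(x,x') + C` for all `x, x'`, and every
vertex of `Y` lies within distance `C` of the image of `f`. -/
def IsQuasiIsometry (X Y : GTree G) (f : X.V → Y.V) : Prop :=
  ∃ K C : ℝ, 1 ≤ K ∧ 0 ≤ C ∧
    (∀ x x' : X.V,
      K⁻¹ * (X.graph.dist x x' : ℝ) - C ≤ (Y.graph.dist (f x) (f x') : ℝ) ∧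
      (Y.graph.dist (f x) (f x') : ℝ) ≤ K * (X.graph.dist x x' : ℝ) + C) ∧
    ∀ y : Y.V, ∃ x : X.V, (Y.graph.dist (f x) y : ℝ) < C

/-- `f : X → Y` is coarsely equivariant: `d(f (γ x), γ (f x)) < L` for some
constant `L` and all `γ`, `x`. -/
def CoarselyEquivariant (X Y : GTree G) (f : X.V → Y.V) : Prop :=
  ∃ L : ℝ, ∀ (γ : G) (x : X.V),
    (Y.graph.dist (f (X.smul γ x)) (Y.smul γ (f x)) : ℝ) < L

end GTree

namespace SimpleGraph

variable {V : Type*} {T : SimpleGraph V}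

/-- The Gromov product of `a` and `b` based at `c`. -/
noncomputable def gromovProd (T : SimpleGraph V) (c a b : V) : ℕ :=
  (T.dist c a + T.dist c b - T.dist a b) / 2

lemma gromovProd_comm (T : SimpleGraph V) (c a b : V) :
    T.gromovProd c a b = T.gromovProd c b a := by
  simp only [gromovProd, T.dist_comm (u := b), add_comm (T.dist c b)]

lemma Connected.exists_adj_dist_add_one (hT : T.Connected) {a b : V} (h : a ≠ b) :
    ∃ c, T.Adj a c ∧ T.dist a b = T.dist c b + 1 := by
  obtain ⟨p, hp⟩ := hT.exists_walk_length_eq_dist a b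
  cases p with
  | nil => exact absurd rfl h
  | @cons _ c _ hac q =>
    refine ⟨c, hac, ?_⟩
    have h1 := dist_le q
    have h2 := hT.dist_triangle (u := a) (v := c) (w := b)
    have h3 := dist_eq_one_iff_adj.2 hac
    simp only [Walk.length_cons] at hp
    omega

lemma Connected.exists_dist_eq (hT : T.Connected) (a b : V) {i : ℕ} (hi : i ≤ T.dist a b) :
    ∃ m, T.dist a m = i ∧ T.dist a m + T.dist m b = T.dist a b := by
  induction i with
  | zero => exact ⟨a, by simp⟩
  | succ i ih =>
    obtain ⟨m, h1, h2⟩ := ih (by omega)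
    have hne : m ≠ b := by
      rintro rfl
      omega
    obtain ⟨c, hc, h3⟩ := hT.exists_adj_dist_add_one hne
    have h4 := hT.dist_triangle (u := a) (v := m) (w := c)
    have h5 := hT.dist_triangle (u := a) (v := c) (w := b)
    have h6 := dist_eq_one_iff_adj.2 hc
    exact ⟨c, by omega, by omega⟩

namespace IsTree

variable (hT : T.IsTree)
include hT

lemma eq_of_adj_of_closer {a b u v : V} (hu : T.Adj b u) (hv : T.Adj b v)
    (hau : T.dist a b = T.dist a u + 1) (hav : T.dist a b = T.dist a v + 1) : u = v := by
  obtain ⟨p, hp⟩ := hT.connected.exists_walk_length_eq_dist a u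
  obtain ⟨q, hq⟩ := hT.connected.exists_walk_length_eq_dist a v
  have hp' := (p.concat hu.symm).isPath_of_length_eq_dist (by rw [Walk.length_concat]; omega)
  have hq' := (q.concat hv.symm).isPath_of_length_eq_dist (by rw [Walk.length_concat]; omega)
  have h := congrArg (fun r : T.Path a b => r.1.penultimate)
    ((hT.isAcyclic.subsingleton_path a b).elim ⟨_, hp'⟩ ⟨_, hq'⟩)
  simpa using h

lemma dist_eq_of_separating_adj {x w w' : V} (hw : T.Adj w w')
    (hx : T.dist x w' = T.dist x w + 1) (z : V) (hz : T.dist w z = T.dist w' z + 1) :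
    T.dist x z = T.dist x w + 1 + T.dist w' z := by
  induction hk : T.dist w' z using Nat.strong_induction_on generalizing z with
  | _ k ih =>
    have hc := hT.connected
    rcases Nat.eq_zero_or_pos k with rfl | hpos
    · rw [← hc.dist_eq_zero_iff.1 hk]
      omega
    have step : ∀ z, 0 < T.dist w' z → T.dist w z = T.dist w' z + 1 →
        ∃ z', T.Adj z z' ∧ T.dist w' z = T.dist w' z' + 1 ∧ T.dist w z' = T.dist w' z' + 1 := by
      intro z hp hwz
      have hne : z ≠ w' := by
        rintro rfl
        simp at hp
      obtain ⟨z', hz', h1⟩ := hc.exists_adj_dist_add_one hne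
      have h2 := hc.dist_triangle (u := w) (v := w') (w := z')
      have h3 := hc.dist_triangle (u := w) (v := z') (w := z)
      have h4 := dist_eq_one_iff_adj.2 hz'.symm
      have h5 := dist_eq_one_iff_adj.2 hw
      rw [T.dist_comm, T.dist_comm (u := z')] at h1
      exact ⟨z', hz', by omega, by omega⟩
    obtain ⟨z', hz', h1, h2⟩ := step z (by omega) hz
    have h3 := ih _ (by omega) z' h2 rfl
    rcases hT.dist_eq_dist_add_one_of_adj x hz' with h | h
    · omega
    exfalso
    rcases Nat.eq_zero_or_pos (T.dist w' z') with h0 | h0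
    · have := hc.dist_eq_zero_iff.1 h0
      subst this
      have := hT.eq_of_adj_of_closer hz'.symm hw.symm h hx
      subst this
      simp at hz
    · obtain ⟨z'', hz'', h4, h5⟩ := step z' h0 h2
      have h6 := ih _ (by omega) z'' h5 rfl
      have := hT.eq_of_adj_of_closer hz'.symm hz'' h (by omega)
      subst this
      omega

/-- The four-point condition. -/
lemma four_point (x y z w : V) :
    T.dist x y + T.dist z w ≤
      max (T.dist x z + T.dist y w) (T.dist x w + T.dist y z) := by
  have hc := hT.connected
  induction hk : T.dist z w generalizing w with
  | zero =>
    have h1 := hc.dist_triangle (u := x) (v := z) (w := y)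
    have h2 := hc.dist_eq_zero_iff.1 hk
    have h3 := T.dist_comm (u := y) (v := z)
    subst h2
    omega
  | succ k ih =>
    have hne : w ≠ z := by
      rintro rfl
      simp at hk
    obtain ⟨w', hw, h1⟩ := hc.exists_adj_dist_add_one hne
    have h2 := T.dist_comm (u := w) (v := z)
    have h3 := T.dist_comm (u := w') (v := z)
    have h4 := ih w' (by omega)
    have h5 := hc.dist_triangle (u := x) (v := w) (w := y)
    have h6 := T.dist_comm (u := w) (v := y)
    have h7 := T.dist_comm (u := w) (v := x)
    rcases hT.dist_eq_dist_add_one_of_adj x hw with h | h <;>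
      rcases hT.dist_eq_dist_add_one_of_adj y hw with h' | h'
    · omega
    · have := hT.dist_eq_of_separating_adj hw h' z (by omega)
      omega
    · have := hT.dist_eq_of_separating_adj hw h z (by omega)
      omega
    · have := hT.dist_eq_of_separating_adj hw h z (by omega)
      omega

lemma even_dist_add (a b c : V) : Even (T.dist c a + T.dist c b + T.dist a b) := by
  obtain ⟨p⟩ := hT.connected.preconnected c b
  induction p using Walk.concatRec with
  | Hnil => simp [T.dist_comm (u := a), ← two_mul]
  | Hconcat p h ih =>
    rw [Nat.even_iff] at *
    rename_i u v w
    have h1 := hT.dist_eq_dist_add_one_of_adj a h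
    have h2 := hT.dist_eq_dist_add_one_of_adj u h
    omega

lemma gromovProd_eq (c a b : V) :
    T.dist c a + T.dist c b = T.dist a b + 2 * T.gromovProd c a b := by
  have h1 := hT.even_dist_add a b c
  have h2 := hT.connected.dist_triangle (u := a) (v := c) (w := b)
  have h3 := T.dist_comm (u := a) (v := c)
  rw [Nat.even_iff] at h1
  unfold gromovProd
  omega

lemma gromovProd_le_left (c a b : V) : T.gromovProd c a b ≤ T.dist c a := by
  have h1 := hT.gromovProd_eq c a b
  have h2 := hT.connected.dist_triangle (u := c) (v := a) (w := b)
  omega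

lemma gromovProd_add (c a b : V) :
    T.gromovProd c a b + T.gromovProd a c b = T.dist c a := by
  have h1 := hT.gromovProd_eq c a b
  have h2 := hT.gromovProd_eq a c b
  have h3 := T.dist_comm (u := a) (v := c)
  omega

lemma min_le_gromovProd (o a b c : V) :
    min (T.gromovProd o a b) (T.gromovProd o b c) ≤ T.gromovProd o a c := by
  have h1 := hT.gromovProd_eq o a b
  have h2 := hT.gromovProd_eq o b c
  have h3 := hT.gromovProd_eq o a c
  have h4 := hT.four_point a c o b
  have h5 := T.dist_comm (u := a) (v := o)
  have h6 := T.dist_comm (u := c) (v := o)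
  have h7 := T.dist_comm (u := c) (v := b)
  omega

lemma btw_of_le_gromovProd {c a b m : V} (hm : T.dist c m + T.dist m a = T.dist c a)
    (h : T.dist c m ≤ T.gromovProd c a b) : T.dist c m + T.dist m b = T.dist c b := by
  have h1 := hT.gromovProd_eq c a b
  have h2 := hT.four_point m b c a
  have h3 := hT.connected.dist_triangle (u := c) (v := m) (w := b)
  have h4 := T.dist_comm (u := m) (v := c)
  have h5 := T.dist_comm (u := b) (v := a)
  have h6 := T.dist_comm (u := b) (v := c)
  omega

lemma le_gromovProd {c a b m : V} (hma : T.dist c m + T.dist m a = T.dist c a)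
    (hmb : T.dist c m + T.dist m b = T.dist c b) : T.dist c m ≤ T.gromovProd c a b := by
  have h1 := hT.gromovProd_eq c a b
  have h2 := hT.connected.dist_triangle (u := a) (v := m) (w := b)
  have h3 := T.dist_comm (u := a) (v := m)
  omega

lemma eq_of_btw {a b m m' : V} (hm : T.dist a m + T.dist m b = T.dist a b)
    (hm' : T.dist a m' + T.dist m' b = T.dist a b) (h : T.dist a m = T.dist a m') : m = m' := by
  have h1 := hT.four_point m m' a b
  have h2 := T.dist_comm (u := m) (v := a)
  have h3 := T.dist_comm (u := m') (v := a)
  exact hT.connected.dist_eq_zero_iff.1 (by omega)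

end IsTree

end SimpleGraph

namespace GTree

variable {G : Type u} [Group G]

section Basic

variable (X : GTree G)

lemma smul_inv_smul (γ : G) (x : X.V) : X.smul γ (X.smul γ⁻¹ x) = x := by
  rw [← X.smul_mul, mul_inv_cancel, X.smul_one]

lemma inv_smul_smul (γ : G) (x : X.V) : X.smul γ⁻¹ (X.smul γ x) = x := by
  rw [← X.smul_mul, inv_mul_cancel, X.smul_one]

lemma smul_injective (γ : G) : Function.Injective (X.smul γ) :=
  Function.LeftInverse.injective (X.inv_smul_smul γ)

lemma dist_smul_smul (γ : G) (x y : X.V) :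
    X.graph.dist (X.smul γ x) (X.smul γ y) = X.graph.dist x y := by
  have key : ∀ (γ : G) (x y : X.V),
      X.graph.dist (X.smul γ x) (X.smul γ y) ≤ X.graph.dist x y := by
    intro γ x y
    obtain ⟨p, hp⟩ := X.isTree.connected.exists_walk_length_eq_dist x y
    let f : X.graph →g X.graph := ⟨X.smul γ, fun h => X.smul_adj γ h⟩
    rw [← hp, ← SimpleGraph.Walk.length_map f p]
    exact SimpleGraph.dist_le _
  refine le_antisymm (key γ x y) ?_
  simpa only [inv_smul_smul] using key γ⁻¹ (X.smul γ x) (X.smul γ y)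

variable {X}

lemma mem_stab {γ : G} {x : X.V} : γ ∈ X.stab x ↔ X.smul γ x = x := Iff.rfl

lemma smul_eq_of_btw {γ : G} {a b m : X.V} (ha : X.smul γ a = a) (hb : X.smul γ b = b)
    (hm : X.graph.dist a m + X.graph.dist m b = X.graph.dist a b) : X.smul γ m = m := by
  have h1 := X.dist_smul_smul γ a m
  have h2 := X.dist_smul_smul γ m b
  rw [ha] at h1
  rw [hb] at h2
  exact X.isTree.eq_of_btw (by omega) hm h1

/-- A subgroup with a bounded orbit fixes a vertex, which lies close to the orbit. -/
lemma exists_fixed_of_bounded_orbit (H : Subgroup G) (x : X.V) (R : ℕ)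
    (hR : ∀ γ ∈ H, X.graph.dist x (X.smul γ x) ≤ R) :
    ∃ p, (∀ γ ∈ H, X.smul γ p = p) ∧ X.graph.dist p x ≤ R := by
  classical
  have hc := X.isTree.connected
  let P : ℕ → Prop := fun r => ∃ p, ∀ γ ∈ H, X.graph.dist p (X.smul γ x) ≤ r
  have hP : ∃ r, P r := ⟨R, x, hR⟩
  obtain ⟨p, hp⟩ := Nat.find_spec hP
  have hle : Nat.find hP ≤ R := Nat.find_min' hP ⟨x, hR⟩
  have hmin : ∀ s, P s → Nat.find hP ≤ s := fun s hs => Nat.find_min' hP hs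
  generalize Nat.find hP = r at hp hle hmin
  have close : ∀ q, (∀ γ ∈ H, X.graph.dist q (X.smul γ x) ≤ r) → X.graph.dist p q ≤ 1 := by
    intro q hq
    by_contra hlt
    obtain ⟨m, hm1, hm2⟩ := hc.exists_dist_eq p q (i := 1) (by omega)
    have hm3 := X.graph.dist_comm (u := p) (v := m)
    have hm : ∀ γ ∈ H, X.graph.dist m (X.smul γ x) + 1 ≤ r := by
      intro γ hγ
      have h1 := X.isTree.four_point m (X.smul γ x) p q
      have h2 := hp γ hγ
      have h3 := hq γ hγ
      rw [X.graph.dist_comm] at h2 h3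
      omega
    have h1 := hm 1 H.one_mem
    have h2 := hmin (r - 1) ⟨m, fun γ hγ => by have := hm γ hγ; omega⟩
    omega
  have inv : ∀ q, (∀ γ ∈ H, X.graph.dist q (X.smul γ x) ≤ r) → ∀ δ ∈ H, ∀ γ ∈ H,
      X.graph.dist (X.smul δ q) (X.smul γ x) ≤ r := by
    intro q hq δ hδ γ hγ
    have h1 := hq (δ⁻¹ * γ) (H.mul_mem (H.inv_mem hδ) hγ)
    rwa [← X.dist_smul_smul δ, X.smul_mul, smul_inv_smul] at h1
  refine ⟨p, fun γ hγ => ?_, ?_⟩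
  · by_contra hne
    have h1 := inv p hp γ hγ
    have h2 := inv _ h1 γ hγ
    have h3 := close _ h1
    have h4 := close _ h2
    have h5 := hc.pos_dist_of_ne (Ne.symm hne)
    have hadj : X.graph.Adj p (X.smul γ p) := SimpleGraph.dist_eq_one_iff_adj.1 (by omega)
    have h6 := X.isTree.dist_ne_of_adj p (X.smul_adj γ hadj)
    have h7 := hc.dist_eq_zero_iff.1 (show X.graph.dist p (X.smul γ (X.smul γ p)) = 0 by omega)
    exact X.no_inversions γ _ _ hadj ⟨rfl, h7.symm⟩
  · have h1 := hp 1 H.one_mem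
    rw [X.smul_one] at h1
    omega

lemma Reduced.exists_smul_eq (hX : X.Reduced) {x y : X.V} (hadj : X.graph.Adj x y)
    (h : X.stab x ≤ X.stab y) : ∃ γ, X.smul γ x = y :=
  hX ⟨(x, y), hadj⟩ (inf_eq_left.2 h)

lemma StronglySlideFree.exists_smul_eq (hX : X.StronglySlideFree) {v w u : X.V}
    (hw : X.graph.Adj v w) (hu : X.graph.Adj v u)
    (h : ∀ γ, X.smul γ v = v → X.smul γ w = w → X.smul γ u = u) :
    ∃ γ, X.smul γ v = v ∧ X.smul γ w = u := by
  obtain ⟨γ, hγ⟩ := hX.2 ⟨(v, w), hw⟩ ⟨(v, u), hu⟩ rfl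
    (fun γ hγ => ⟨hγ.1, h γ hγ.1 hγ.2⟩)
  have h1 := congrArg (fun e : X.Edge => e.1) hγ
  exact ⟨γ, congrArg Prod.fst h1, congrArg Prod.snd h1⟩

lemma isInvariantSubtree_of_convex {S : Set X.V} (hne : S.Nonempty)
    (hinv : ∀ γ, ∀ x ∈ S, X.smul γ x ∈ S)
    (hconv : ∀ x ∈ S, ∀ y ∈ S, ∀ m,
      X.graph.dist x m + X.graph.dist m y = X.graph.dist x y → m ∈ S) :
    X.IsInvariantSubtree S := by
  classical
  refine ⟨hne, hinv, fun x hx y hy => ?_⟩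
  obtain ⟨p, hp⟩ := X.isTree.connected.exists_walk_length_eq_dist x y
  refine ⟨p, fun m hm => hconv x hx y hy m (le_antisymm ?_ X.isTree.connected.dist_triangle)⟩
  have h1 := congrArg SimpleGraph.Walk.length (p.take_spec hm)
  rw [SimpleGraph.Walk.length_append] at h1
  have h2 := SimpleGraph.dist_le (p.takeUntil m hm)
  have h3 := SimpleGraph.dist_le (p.dropUntil m hm)
  omega

lemma StronglySlideFree.not_stab_le_of_adj (hX : X.StronglySlideFree) {v w : X.V}
    (hw : X.graph.Adj v w) : ¬ X.stab v ≤ X.stab w := by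
  intro hle
  have hleaf : ∀ u, X.graph.Adj v u → u = w := by
    intro u hu
    obtain ⟨δ, h1, h2⟩ := hX.exists_smul_eq hu hw fun δ hδ _ => hle hδ
    exact X.smul_injective δ (h2.trans (hle h1).symm)
  have hleaf' : ∀ γ u, X.graph.Adj (X.smul γ v) u → u = X.smul γ w := by
    intro γ u hu
    have h1 := X.smul_adj γ⁻¹ hu
    rw [inv_smul_smul] at h1
    rw [← hleaf _ h1, smul_inv_smul]
  have hsub : X.IsInvariantSubtree {x | ∀ γ, X.smul γ v ≠ x} := by
    refine isInvariantSubtree_of_convex ⟨w, fun γ hγ => ?_⟩ (fun δ x hx γ hγ => ?_)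
      (fun x hx y hy m hm γ hγ => ?_)
    · have h1 := hleaf' γ v (hγ ▸ hw.symm)
      exact X.no_inversions γ v w hw ⟨hγ, h1.symm⟩
    · apply hx (δ⁻¹ * γ)
      rw [X.smul_mul, hγ, inv_smul_smul]
    · subst hγ
      have hc := X.isTree.connected
      obtain ⟨a, ha, h1⟩ := hc.exists_adj_dist_add_one (hx γ)
      obtain ⟨b, hb, h2⟩ := hc.exists_adj_dist_add_one (hy γ)
      obtain rfl := (hleaf' γ a ha).trans (hleaf' γ b hb).symm
      have h3 := hc.dist_triangle (u := x) (v := a) (w := y)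
      rw [X.graph.dist_comm] at h1
      rw [X.graph.dist_comm (u := a) (v := x)] at h1
      omega
  have h1 : v ∈ {x | ∀ γ, X.smul γ v ≠ x} := by
    rw [hX.1 _ hsub]
    trivial
  exact h1 1 (X.smul_one v)

lemma StronglySlideFree.eq_of_stab_le (hX : X.StronglySlideFree) {x x' : X.V}
    (h : X.stab x ≤ X.stab x') : x = x' := by
  by_contra hne
  obtain ⟨c, hc, h1⟩ := X.isTree.connected.exists_adj_dist_add_one hne
  have h2 := SimpleGraph.dist_eq_one_iff_adj.2 hc
  exact hX.not_stab_le_of_adj hc fun γ hγ => smul_eq_of_btw hγ (h hγ) (by omega)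

lemma mem_stab_smul {γ g : G} {x : X.V} : γ ∈ X.stab (X.smul g x) ↔ g⁻¹ * γ * g ∈ X.stab x := by
  rw [mem_stab, mem_stab, X.smul_mul, X.smul_mul]
  constructor
  · intro h
    rw [h, inv_smul_smul]
  · intro h
    rw [← smul_inv_smul X g (X.smul γ (X.smul g x)), h]

end Basic

end GTree

namespace GTree

variable {G : Type u} [Group G]

/-- An equivariant map preserving vertex stabilizers, from a strongly slide-free tree to a reduced
tree whose elliptic subgroups are elliptic in the source. -/
structure IsStabPreserving (X Y : GTree G) (ψ : X.V → Y.V) : Prop where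
  ssf : X.StronglySlideFree
  reduced : Y.Reduced
  elliptic : ∀ y, ∃ x, Y.stab y ≤ X.stab x
  map_smul : ∀ γ x, ψ (X.smul γ x) = Y.smul γ (ψ x)
  stab_map : ∀ x, Y.stab (ψ x) = X.stab x

namespace IsStabPreserving

variable {X Y : GTree G} {ψ : X.V → Y.V} (h : IsStabPreserving X Y ψ)
include h

lemma smul_map_of_eq {γ : G} {x x' : X.V} (hx : X.smul γ x = x') :
    Y.smul γ (ψ x) = ψ x' := by
  rw [← h.map_smul, hx]

lemma smul_eq_of_map {γ : G} {x : X.V} (hx : Y.smul γ (ψ x) = ψ x) : X.smul γ x = x := by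
  rw [← mem_stab, ← h.stab_map]
  exact hx

lemma eq_of_stab_map_le {x x' : X.V} (hle : Y.stab (ψ x) ≤ Y.stab (ψ x')) : x = x' :=
  h.ssf.eq_of_stab_le (by rwa [h.stab_map, h.stab_map] at hle)

lemma injective : Function.Injective ψ := fun x x' hx =>
  h.eq_of_stab_map_le (by rw [hx])

lemma pos_dist {v w : X.V} (hw : X.graph.Adj v w) : 0 < Y.graph.dist (ψ v) (ψ w) :=
  Y.isTree.connected.pos_dist_of_ne (h.injective.ne hw.ne)

lemma not_stab_le {v : X.V} {y : Y.V} (hy : Y.graph.Adj y (ψ v)) : ¬ Y.stab y ≤ X.stab v := by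
  intro hle
  obtain ⟨γ, hγ⟩ := h.reduced.exists_smul_eq hy (by rwa [h.stab_map])
  obtain rfl : y = ψ (X.smul γ⁻¹ v) := by rw [h.map_smul, ← hγ, inv_smul_smul]
  rw [h.stab_map] at hle
  rw [h.ssf.eq_of_stab_le hle] at hy
  exact hy.ne rfl

/-- If the images of two edges at `v` share an initial segment, then some element of `G` carries
one edge to the other and fixes this segment. -/
lemma exists_smul_eq_of_gromovProd_pos {v w₁ w₂ : X.V} (hw₁ : X.graph.Adj v w₁)
    (hw₂ : X.graph.Adj v w₂) (hgp : 1 ≤ Y.graph.gromovProd (ψ v) (ψ w₁) (ψ w₂)) :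
    ∃ γ, X.smul γ v = v ∧ X.smul γ w₁ = w₂ ∧ ∀ m,
      Y.graph.dist (ψ v) m + Y.graph.dist m (ψ w₁) = Y.graph.dist (ψ v) (ψ w₁) →
      Y.graph.dist (ψ v) m ≤ Y.graph.gromovProd (ψ v) (ψ w₁) (ψ w₂) → Y.smul γ m = m := by
  have hle := Y.isTree.gromovProd_le_left (ψ v) (ψ w₁) (ψ w₂)
  obtain ⟨y, hy, hy₁⟩ := Y.isTree.connected.exists_dist_eq (ψ v) (ψ w₁) (hgp.trans hle)
  have hy₂ := Y.isTree.btw_of_le_gromovProd (b := ψ w₂) hy₁ (by omega)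
  obtain ⟨z, hz⟩ := h.elliptic y
  have hvz : v ≠ z := by
    rintro rfl
    exact h.not_stab_le (SimpleGraph.dist_eq_one_iff_adj.1 hy).symm hz
  obtain ⟨u, hu, hvu⟩ := X.isTree.connected.exists_adj_dist_add_one hvz
  have key : ∀ w, X.graph.Adj v w →
      Y.graph.dist (ψ v) y + Y.graph.dist y (ψ w) = Y.graph.dist (ψ v) (ψ w) →
      ∃ γ, X.smul γ v = v ∧ X.smul γ w = u := by
    intro w hw hyw
    refine h.ssf.exists_smul_eq hw hu fun γ hγv hγw => ?_
    have h1 := smul_eq_of_btw (h.smul_map_of_eq hγv) (h.smul_map_of_eq hγw) hyw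
    have h2 := SimpleGraph.dist_eq_one_iff_adj.2 hu
    exact smul_eq_of_btw hγv (hz h1) (by omega)
  obtain ⟨α, hαv, hαw⟩ := key w₁ hw₁ hy₁
  obtain ⟨β, hβv, hβw⟩ := key w₂ hw₂ hy₂
  have hγv : X.smul (β⁻¹ * α) v = v := by
    conv_lhs => rw [X.smul_mul, hαv, ← hβv, inv_smul_smul]
  have hγw : X.smul (β⁻¹ * α) w₁ = w₂ := by
    rw [X.smul_mul, hαw, ← hβw, inv_smul_smul]
  refine ⟨β⁻¹ * α, hγv, hγw, fun m hm hmle => ?_⟩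
  have h1 := Y.isTree.btw_of_le_gromovProd hm hmle
  have h2 := Y.dist_smul_smul (β⁻¹ * α) (ψ v) m
  have h3 := Y.dist_smul_smul (β⁻¹ * α) m (ψ w₁)
  have h4 := Y.dist_smul_smul (β⁻¹ * α) (ψ v) (ψ w₁)
  rw [h.smul_map_of_eq hγv] at h2 h4
  rw [h.smul_map_of_eq hγw] at h3 h4
  exact Y.isTree.eq_of_btw (by omega) h1 h2

lemma gromovProd_lt_dist {v w u : X.V} (hw : X.graph.Adj w v) (hu : X.graph.Adj w u)
    (hne : u ≠ v) : Y.graph.gromovProd (ψ w) (ψ v) (ψ u) < Y.graph.dist (ψ w) (ψ v) := by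
  by_contra! hge
  have hpos := h.pos_dist hw
  obtain ⟨γ, -, hγv, hγ⟩ := h.exists_smul_eq_of_gromovProd_pos hw hu (by omega)
  exact hne (hγv.symm.trans (h.smul_eq_of_map (hγ (ψ v) (by simp) hge)))

lemma gromovProd_add_lt_dist {u₁ v w u₂ : X.V} (hw : X.graph.Adj v w) (hu₁ : X.graph.Adj v u₁)
    (hu₂ : X.graph.Adj w u₂) (hne₁ : u₁ ≠ w) (hne₂ : u₂ ≠ v) :
    Y.graph.gromovProd (ψ v) (ψ w) (ψ u₁) + Y.graph.gromovProd (ψ w) (ψ v) (ψ u₂) <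
      Y.graph.dist (ψ v) (ψ w) := by
  by_contra! hge
  have h1 := h.gromovProd_lt_dist hw hu₁ hne₁
  have h2 := h.gromovProd_lt_dist hw.symm hu₂ hne₂
  have hcomm := Y.graph.dist_comm (u := ψ w) (v := ψ v)
  obtain ⟨α, hαv, hαw, hα⟩ := h.exists_smul_eq_of_gromovProd_pos hw hu₁ (by omega)
  obtain ⟨β, hβw, hβv, hβ⟩ := h.exists_smul_eq_of_gromovProd_pos hw.symm hu₂ (by omega)
  obtain ⟨m, hm, hmb⟩ := Y.isTree.connected.exists_dist_eq (ψ v) (ψ w) h1.le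
  have hm1 := Y.graph.dist_comm (u := ψ w) (v := m)
  have hm2 := Y.graph.dist_comm (u := m) (v := ψ v)
  obtain ⟨z, hz⟩ := h.elliptic m
  have hαz := hz (hα m hmb hm.le)
  have hβz := hz (hβ m (by omega) (by omega))
  have hadj := SimpleGraph.dist_eq_one_iff_adj.2 hw
  have hadj' := SimpleGraph.dist_eq_one_iff_adj.2 hw.symm
  have h3 := X.graph.dist_comm (u := z) (v := v)
  have h4 := X.graph.dist_comm (u := z) (v := w)
  rcases X.isTree.dist_eq_dist_add_one_of_adj z hw with h5 | h5
  · exact hne₁ (hαw.symm.trans (smul_eq_of_btw hαv hαz (by omega)))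
  · exact hne₂ (hβv.symm.trans (smul_eq_of_btw hβw hβz (by omega)))

/-- Gromov products at the images of interior vertices of geodesics are determined locally. -/
lemma gromovProd_map_of_geodesic {u₀ u₁ u₂ z : X.V} (h₀ : X.graph.Adj u₀ u₁)
    (h₀z : X.graph.dist u₀ z = X.graph.dist u₁ z + 1) (h₁ : X.graph.Adj u₁ u₂)
    (h₁z : X.graph.dist u₁ z = X.graph.dist u₂ z + 1) :
    Y.graph.gromovProd (ψ u₁) (ψ u₀) (ψ z) = Y.graph.gromovProd (ψ u₁) (ψ u₀) (ψ u₂) ∧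
      Y.graph.gromovProd (ψ u₁) (ψ u₀) (ψ z) < Y.graph.dist (ψ u₁) (ψ z) ∧
      Y.graph.gromovProd (ψ u₁) (ψ u₀) (ψ z) < Y.graph.dist (ψ u₁) (ψ u₀) := by
  induction hk : X.graph.dist u₂ z generalizing u₀ u₁ u₂ with
  | zero =>
    have hne : u₂ ≠ u₀ := by
      rintro rfl
      omega
    obtain rfl := X.isTree.connected.dist_eq_zero_iff.1 hk
    refine ⟨rfl, ?_, h.gromovProd_lt_dist h₀.symm h₁ hne⟩
    rw [SimpleGraph.gromovProd_comm]
    exact h.gromovProd_lt_dist h₁ h₀.symm hne.symm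
  | succ k ih =>
    have hne₀ : u₂ ≠ u₀ := by
      rintro rfl
      omega
    have hne : u₂ ≠ z := by
      rintro rfl
      simp at hk
    obtain ⟨u₃, h₂, h₂z⟩ := X.isTree.connected.exists_adj_dist_add_one hne
    have hne₃ : u₃ ≠ u₁ := by
      rintro rfl
      omega
    obtain ⟨h1, h2, h3⟩ := ih h₁ h₁z h₂ h₂z (by omega)
    have h4 := h.gromovProd_add_lt_dist h₁ h₀.symm h₂ hne₀.symm hne₃
    have h5 := Y.isTree.gromovProd_add (ψ u₁) (ψ u₂) (ψ z)
    have h6 := Y.isTree.min_le_gromovProd (ψ u₁) (ψ u₀) (ψ u₂) (ψ z)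
    have h7 := Y.isTree.min_le_gromovProd (ψ u₁) (ψ u₀) (ψ z) (ψ u₂)
    have h8 := Y.isTree.gromovProd_le_left (ψ u₁) (ψ z) (ψ u₂)
    have h9 := h.gromovProd_lt_dist h₀.symm h₁ hne₀
    rw [Y.graph.gromovProd_comm (ψ u₁) (ψ u₂) (ψ u₀)] at h4
    rw [Y.graph.gromovProd_comm (ψ u₁) (ψ z) (ψ u₂)] at h7 h8
    omega

lemma gromovProd_pos_of_geodesic {v u z : X.V} (hu : X.graph.Adj v u)
    (hz : X.graph.dist v z = X.graph.dist u z + 1) :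
    1 ≤ Y.graph.gromovProd (ψ v) (ψ u) (ψ z) := by
  have h1 := Y.isTree.gromovProd_add (ψ v) (ψ u) (ψ z)
  have h2 := Y.graph.dist_comm (u := ψ v) (v := ψ u)
  by_cases huz : u = z
  · subst huz
    have h3 := Y.isTree.gromovProd_eq (ψ v) (ψ u) (ψ u)
    have h4 := h.pos_dist hu
    simp only [SimpleGraph.dist_self] at h3
    omega
  · obtain ⟨u', hu', huz'⟩ := X.isTree.connected.exists_adj_dist_add_one huz
    have h3 := (h.gromovProd_map_of_geodesic hu hz hu' huz').2.2
    omega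

end IsStabPreserving

end GTree

namespace GTree

namespace IsStabPreserving

variable {G : Type u} [Group G] {X Y : GTree G} {ψ : X.V → Y.V} (h : IsStabPreserving X Y ψ)
include h

lemma exists_adj_toward {v w₀ z : X.V} {y : Y.V} (hw₀ : X.graph.Adj v w₀)
    (hd : 2 ≤ Y.graph.dist (ψ v) (ψ w₀)) (hy : Y.graph.dist (ψ v) y = 1)
    (hyb : Y.graph.dist (ψ v) y + Y.graph.dist y (ψ w₀) = Y.graph.dist (ψ v) (ψ w₀))
    (hz : Y.stab y ≤ X.stab z) :
    ∃ w, X.graph.Adj v w ∧ X.graph.dist v z = X.graph.dist w z + 1 ∧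
      2 ≤ Y.graph.dist (ψ v) (ψ w) ∧
      Y.graph.dist (ψ v) y + Y.graph.dist y (ψ w) = Y.graph.dist (ψ v) (ψ w) := by
  have hadj : Y.graph.Adj y (ψ v) := (SimpleGraph.dist_eq_one_iff_adj.1 hy).symm
  have hvz : v ≠ z := by
    rintro rfl
    exact h.not_stab_le hadj hz
  obtain ⟨w, hw, hwz⟩ := X.isTree.connected.exists_adj_dist_add_one hvz
  by_cases hne : w = w₀
  · subst hne
    exact ⟨w, hw, hwz, hd, hyb⟩
  have hw₀z : X.graph.dist w₀ z = X.graph.dist v z + 1 := by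
    rw [X.graph.dist_comm, X.graph.dist_comm (u := v)]
    refine (X.isTree.dist_eq_dist_add_one_of_adj z hw₀).resolve_left fun h1 => hne ?_
    refine X.isTree.eq_of_adj_of_closer (a := z) hw hw₀ ?_ h1
    rwa [X.graph.dist_comm, X.graph.dist_comm (v := w)]
  have h1 := (h.gromovProd_map_of_geodesic hw₀.symm hw₀z hw hwz).1
  have hpos : 1 ≤ Y.graph.gromovProd (ψ v) (ψ w₀) (ψ w) := by
    by_contra hlt
    have h2 := Y.isTree.gromovProd_eq (ψ v) (ψ w₀) (ψ z)
    have h3 := Y.isTree.connected.dist_triangle (u := ψ w₀) (v := y) (w := ψ z)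
    have h4 := Y.isTree.connected.dist_triangle (u := y) (v := ψ v) (w := ψ z)
    have h5 := Y.graph.dist_comm (u := ψ w₀) (v := y)
    have h6 := Y.graph.dist_comm (u := ψ v) (v := y)
    refine h.not_stab_le hadj fun γ hγ => h.smul_eq_of_map ?_
    exact smul_eq_of_btw hγ (h.smul_map_of_eq (hz hγ)) (by omega)
  obtain ⟨γ, hγv, hγw, -⟩ := h.exists_smul_eq_of_gromovProd_pos hw₀ hw hpos
  have h2 := Y.dist_smul_smul γ (ψ v) (ψ w₀)
  rw [h.smul_map_of_eq hγv, h.smul_map_of_eq hγw] at h2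
  exact ⟨w, hw, hwz, by omega, Y.isTree.btw_of_le_gromovProd hyb (by omega)⟩

lemma exists_stab_le_next {v w z : X.V} {y₁ : Y.V} (hw : X.graph.Adj v w)
    (hwz : X.graph.dist v z = X.graph.dist w z + 1)
    (hd : 2 ≤ Y.graph.dist (ψ v) (ψ w)) (hy₁ : Y.graph.dist (ψ v) y₁ = 1)
    (hyb : Y.graph.dist (ψ v) y₁ + Y.graph.dist y₁ (ψ w) = Y.graph.dist (ψ v) (ψ w))
    (hz : Y.stab y₁ ≤ X.stab z) :
    ∃ y₂, Y.graph.Adj y₁ y₂ ∧ Y.graph.dist (ψ v) y₂ = 2 ∧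
      Y.graph.dist (ψ v) y₂ + Y.graph.dist y₂ (ψ w) = Y.graph.dist (ψ v) (ψ w) ∧
      Y.stab y₁ ≤ Y.stab y₂ := by
  have hc := Y.isTree.connected
  have hne : y₁ ≠ ψ w := by
    rintro rfl
    omega
  obtain ⟨y₂, hadj, h1⟩ := hc.exists_adj_dist_add_one hne
  have h2 := SimpleGraph.dist_eq_one_iff_adj.2 hadj
  have h3 := hc.dist_triangle (u := ψ v) (v := y₁) (w := y₂)
  have h4 := hc.dist_triangle (u := ψ v) (v := y₂) (w := ψ w)
  have hy₂ : Y.graph.dist (ψ v) y₂ = 2 := by omega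
  have hyb₂ : Y.graph.dist (ψ v) y₂ + Y.graph.dist y₂ (ψ w) = Y.graph.dist (ψ v) (ψ w) := by omega
  refine ⟨y₂, hadj, hy₂, hyb₂, fun γ hγ => ?_⟩
  by_cases hwz' : w = z
  · subst hwz'
    exact smul_eq_of_btw hγ (h.smul_map_of_eq (hz hγ)) (by omega)
  obtain ⟨u, hu, huz⟩ := X.isTree.connected.exists_adj_dist_add_one hwz'
  obtain ⟨h5, -, h6⟩ := h.gromovProd_map_of_geodesic hw hwz hu huz
  have h7 := Y.isTree.gromovProd_add (ψ v) (ψ w) (ψ z)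
  have h8 := Y.graph.dist_comm (u := ψ w) (v := ψ v)
  have h9 : 2 ≤ Y.graph.gromovProd (ψ v) (ψ w) (ψ z) := by
    by_contra hlt
    obtain ⟨β, hβw, hβv, hβ⟩ := h.exists_smul_eq_of_gromovProd_pos hw.symm hu (by omega)
    have h10 := Y.graph.dist_comm (u := ψ w) (v := y₁)
    have h11 := Y.graph.dist_comm (u := y₁) (v := ψ v)
    have hβz := hz (hβ y₁ (by omega) (by omega))
    have h12 := SimpleGraph.dist_eq_one_iff_adj.2 hu
    have hβu := smul_eq_of_btw hβw hβz (m := u) (by omega)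
    have := X.smul_injective β (hβv.trans hβu.symm)
    subst this
    omega
  have h10 := Y.isTree.btw_of_le_gromovProd (b := ψ z) hyb (by omega)
  have h11 := Y.isTree.btw_of_le_gromovProd (b := ψ z) hyb₂ (by omega)
  exact smul_eq_of_btw hγ (h.smul_map_of_eq (hz hγ)) (by omega)

lemma dist_map_lt_two_of_toward {v w z : X.V} {y₁ : Y.V} (hw : X.graph.Adj v w)
    (hwz : X.graph.dist v z = X.graph.dist w z + 1)
    (hy₁ : Y.graph.dist (ψ v) y₁ = 1)
    (hyb : Y.graph.dist (ψ v) y₁ + Y.graph.dist y₁ (ψ w) = Y.graph.dist (ψ v) (ψ w))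
    (hz : Y.stab y₁ ≤ X.stab z) : Y.graph.dist (ψ v) (ψ w) < 2 := by
  by_contra! hd
  have hc := Y.isTree.connected
  obtain ⟨y₂, hadj, hy₂, hyb₂, hle⟩ := h.exists_stab_le_next hw hwz hd hy₁ hyb hz
  obtain ⟨g, hg⟩ := h.reduced.exists_smul_eq hadj hle
  have hrange : ∀ x, ψ x ≠ y₁ := by
    rintro x rfl
    obtain rfl := h.map_smul g x ▸ hg
    have := h.eq_of_stab_map_le hle
    rw [← this] at hadj
    exact hadj.ne rfl
  have hy₂w : y₂ ≠ ψ w := by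
    intro hy
    apply hrange (X.smul g⁻¹ w)
    rw [h.map_smul, ← hy, ← hg, inv_smul_smul]
  have h1 := hc.pos_dist_of_ne hy₂w
  have h2 := SimpleGraph.dist_eq_one_iff_adj.2 hadj
  obtain ⟨P, hP⟩ : ∃ P, P = ψ (X.smul g v) := ⟨_, rfl⟩
  have hy₂P : Y.graph.dist y₂ P = 1 := by
    rw [hP, h.map_smul, ← hg, Y.dist_smul_smul, Y.graph.dist_comm, hy₁]
  have hy₁P : Y.graph.dist y₁ P = 2 := by
    have h3 := hc.pos_dist_of_ne (hP ▸ (hrange (X.smul g v)).symm : y₁ ≠ P)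
    have h4 := Y.isTree.dist_ne_of_adj P hadj
    rw [Y.graph.dist_comm, Y.graph.dist_comm (u := P)] at h4
    have h5 := hc.dist_triangle (u := y₁) (v := y₂) (w := P)
    omega
  have hvP : Y.graph.dist (ψ v) P = 3 := by
    have h3 := Y.isTree.four_point (ψ v) y₂ y₁ P
    have h4 := hc.dist_triangle (u := ψ v) (v := y₂) (w := P)
    have h5 := Y.graph.dist_comm (u := y₂) (v := y₁)
    omega
  have hvg : v ≠ X.smul g v := by
    intro hv
    rw [hP, ← hv, SimpleGraph.dist_self] at hvP
    omega
  obtain ⟨u₁, hu₁, hu₁g⟩ := X.isTree.connected.exists_adj_dist_add_one hvg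
  have h3 := h.gromovProd_pos_of_geodesic hu₁ hu₁g
  rw [← hP] at h3
  obtain rfl : u₁ = w := by
    have h4 := Y.isTree.btw_of_le_gromovProd (c := ψ v) (a := P) (b := ψ u₁) (m := y₁)
      (by omega) (by rw [SimpleGraph.gromovProd_comm]; omega)
    have h5 := Y.isTree.le_gromovProd hyb h4
    obtain ⟨α, hαv, hαw, hα⟩ := h.exists_smul_eq_of_gromovProd_pos hw hu₁ (by omega)
    have hαz := hz (hα y₁ hyb h5)
    have h6 := SimpleGraph.dist_eq_one_iff_adj.2 hw
    exact hαw.symm.trans (smul_eq_of_btw hαv hαz (by omega))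
  have hcomm := Y.graph.dist_comm (u := ψ u₁) (v := ψ v)
  have hcomm₁ := Y.graph.dist_comm (u := ψ u₁) (v := y₁)
  have hcomm₂ := Y.graph.dist_comm (u := ψ u₁) (v := y₂)
  have hcomm₃ := Y.graph.dist_comm (u := y₁) (v := ψ v)
  have hcomm₄ := Y.graph.dist_comm (u := y₂) (v := ψ v)
  by_cases hug : u₁ = X.smul g v
  · have h4 : Y.graph.dist (ψ u₁) (ψ (X.smul g u₁)) = 3 := by
      rw [h.map_smul g u₁]
      conv_lhs => rw [hug, h.map_smul, Y.dist_smul_smul, ← h.map_smul, ← hP]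
      exact hvP
    have h5 : Y.graph.dist y₂ (ψ (X.smul g u₁)) = 2 := by
      rw [← hug] at hP
      subst hP
      rw [h.map_smul, ← hg, Y.dist_smul_smul]
      omega
    rw [← hug] at hP
    subst hP
    have h6 := Y.isTree.le_gromovProd (c := ψ u₁) (a := ψ v) (b := ψ (X.smul g u₁)) (m := y₂)
      (by omega) (by omega)
    have h7 := X.smul_adj g hw
    rw [← hug] at h7
    obtain ⟨α, hαw, hαv, -⟩ := h.exists_smul_eq_of_gromovProd_pos hw.symm h7 (by omega)
    refine X.no_inversions (α⁻¹ * g) v u₁ hw ⟨?_, ?_⟩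
    · conv_lhs => rw [X.smul_mul, ← hug, ← hαw, inv_smul_smul]
    · rw [X.smul_mul, ← hαv, inv_smul_smul]
  obtain ⟨u₂, hu₂, hu₂g⟩ := X.isTree.connected.exists_adj_dist_add_one hug
  obtain ⟨h4, h5, h6⟩ := h.gromovProd_map_of_geodesic hu₁ hu₁g hu₂ hu₂g
  rw [← hP] at h4 h5 h6
  have h7 := Y.isTree.gromovProd_add (ψ v) (ψ u₁) P
  have h8 := Y.isTree.le_gromovProd (b := P) hyb₂ (by omega)
  have h9 := Y.isTree.gromovProd_eq (ψ u₁) (ψ v) P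
  obtain ⟨β, hβw, hβv, -⟩ := h.exists_smul_eq_of_gromovProd_pos hu₁.symm hu₂ (by omega)
  have h10 : Y.graph.dist (ψ u₁) (ψ u₂) = Y.graph.dist (ψ u₁) (ψ v) := by
    rw [← Y.dist_smul_smul β (ψ u₁) (ψ v), h.smul_map_of_eq hβw, h.smul_map_of_eq hβv]
  have hne : u₂ ≠ X.smul g v := by
    rintro rfl
    rw [← hP] at h10
    omega
  obtain ⟨u₃, hu₃, hu₃g⟩ := X.isTree.connected.exists_adj_dist_add_one hne
  have h11 := (h.gromovProd_map_of_geodesic hu₂ hu₂g hu₃ hu₃g).1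
  have hne₁ : v ≠ u₂ := by
    rintro rfl
    omega
  have hne₂ : u₃ ≠ u₁ := by
    rintro rfl
    omega
  have h12 := h.gromovProd_add_lt_dist hu₂ hu₁.symm hu₃ hne₁ hne₂
  rw [SimpleGraph.gromovProd_comm] at h12
  have h13 := Y.isTree.gromovProd_add (ψ u₁) (ψ u₂) P
  rw [← hP] at h11
  have h14 : Y.graph.dist (ψ u₁) (Y.smul β y₁) = Y.graph.dist (ψ u₁) y₁ := by
    rw [← Y.dist_smul_smul β (ψ u₁) y₁, h.smul_map_of_eq hβw]
  have h15 : Y.graph.dist (Y.smul β y₁) (ψ u₂) = Y.graph.dist y₁ (ψ v) := by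
    rw [← Y.dist_smul_smul β y₁ (ψ v), h.smul_map_of_eq hβv]
  have h16 := Y.isTree.btw_of_le_gromovProd (c := ψ u₁) (a := ψ u₂) (b := P)
    (m := Y.smul β y₁) (by omega) (by omega)
  have h17 : Y.smul β y₁ = P := hc.dist_eq_zero_iff.1 (by omega)
  apply hrange (X.smul β⁻¹ (X.smul g v))
  rw [h.map_smul, ← hP, ← h17, inv_smul_smul]

lemma dist_map_of_adj {v w : X.V} (hw : X.graph.Adj v w) :
    Y.graph.dist (ψ v) (ψ w) = 1 := by
  have hpos := h.pos_dist hw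
  by_contra hd
  obtain ⟨y, hy, hyb⟩ := Y.isTree.connected.exists_dist_eq (ψ v) (ψ w) (i := 1) hpos
  obtain ⟨z, hz⟩ := h.elliptic y
  obtain ⟨w', hw', hwz, hd', hyb'⟩ := h.exists_adj_toward hw (by omega) hy hyb hz
  have := h.dist_map_lt_two_of_toward hw' hwz hy hyb' hz
  omega

lemma dist_map (x x' : X.V) : Y.graph.dist (ψ x) (ψ x') = X.graph.dist x x' := by
  induction hk : X.graph.dist x x' generalizing x with
  | zero =>
    rw [X.isTree.connected.dist_eq_zero_iff.1 hk, SimpleGraph.dist_self]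
  | succ k ih =>
    have hne : x ≠ x' := by
      rintro rfl
      simp at hk
    obtain ⟨u, hu, h1⟩ := X.isTree.connected.exists_adj_dist_add_one hne
    have h2 := ih u (by omega)
    have h3 := h.dist_map_of_adj hu
    have h4 := h.gromovProd_pos_of_geodesic hu h1
    have h5 := Y.isTree.gromovProd_eq (ψ x) (ψ u) (ψ x')
    have h6 := Y.isTree.gromovProd_le_left (ψ x) (ψ u) (ψ x')
    omega

lemma mem_range_of_btw {a b m : Y.V} (ha : a ∈ Set.range ψ) (hb : b ∈ Set.range ψ)
    (hm : Y.graph.dist a m + Y.graph.dist m b = Y.graph.dist a b) : m ∈ Set.range ψ := by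
  obtain ⟨x, rfl⟩ := ha
  obtain ⟨x', rfl⟩ := hb
  have h1 := h.dist_map x x'
  obtain ⟨p, hp, hpb⟩ := X.isTree.connected.exists_dist_eq x x'
    (i := Y.graph.dist (ψ x) m) (by omega)
  have h2 := h.dist_map x p
  have h3 := h.dist_map p x'
  exact ⟨p, Y.isTree.eq_of_btw (by omega) hm (by omega)⟩

lemma surjective : Function.Surjective ψ := by
  classical
  have hc := Y.isTree.connected
  intro y
  by_contra hy
  have hex : ∃ r, ∃ x, Y.graph.dist y (ψ x) = r := by
    obtain ⟨x⟩ := X.isTree.connected.nonempty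
    exact ⟨_, x, rfl⟩
  obtain ⟨x, hx⟩ := Nat.find_spec hex
  have hmin : ∀ x', Nat.find hex ≤ Y.graph.dist y (ψ x') := fun x' => Nat.find_min' hex ⟨x', rfl⟩
  rw [← hx] at hmin
  have hfix : ∀ γ ∈ Y.stab y, Y.smul γ (ψ x) = ψ x := by
    intro γ hγ
    by_contra hne
    have h1 := Y.dist_smul_smul γ y (ψ x)
    rw [mem_stab] at hγ
    rw [hγ] at h1
    obtain ⟨m, hadj, h2⟩ := hc.exists_adj_dist_add_one (Ne.symm hne)
    have h3 := SimpleGraph.dist_eq_one_iff_adj.2 hadj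
    obtain ⟨p, rfl⟩ := h.mem_range_of_btw ⟨x, rfl⟩ ⟨X.smul γ x, h.map_smul γ x⟩
      (by omega : Y.graph.dist (ψ x) m + Y.graph.dist m _ = _)
    have h4 := hmin p
    have h5 := Y.isTree.dist_eq_dist_add_one_of_adj y hadj
    have h6 := Y.isTree.four_point y (ψ p) (ψ x) (Y.smul γ (ψ x))
    have h7 := Y.graph.dist_comm (u := ψ p) (v := ψ x)
    omega
  have hne : y ≠ ψ x := fun hyx => hy ⟨x, hyx.symm⟩
  obtain ⟨y', hadj, h1⟩ := hc.exists_adj_dist_add_one hne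
  have h2 := SimpleGraph.dist_eq_one_iff_adj.2 hadj
  obtain ⟨g, hg⟩ := h.reduced.exists_smul_eq hadj fun γ hγ =>
    smul_eq_of_btw hγ (hfix γ hγ) (by omega)
  have h3 := hmin (X.smul g⁻¹ x)
  rw [h.map_smul, ← Y.dist_smul_smul g y (Y.smul _ _), smul_inv_smul, hg] at h3
  omega

end IsStabPreserving

end GTree

namespace GTree

variable {G : Type u} [Group G] {X Y : GTree G}

lemma stab_eq_of_stab_le (hX : X.StronglySlideFree) (hell : ∀ y, ∃ x, Y.stab y ≤ X.stab x)
    {x : X.V} {y : Y.V} (h : X.stab x ≤ Y.stab y) : Y.stab y = X.stab x := by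
  obtain ⟨x', hx'⟩ := hell y
  obtain rfl := hX.eq_of_stab_le (h.trans hx')
  exact le_antisymm hx' h

lemma eq_of_stab_le_stab (hX : X.StronglySlideFree) (hY : Y.Reduced)
    (hell : ∀ y, ∃ x, Y.stab y ≤ X.stab x) {x : X.V} {y y' : Y.V}
    (h : X.stab x ≤ Y.stab y) (h' : X.stab x ≤ Y.stab y') : y = y' := by
  by_contra hne
  obtain ⟨y₁, hadj, h1⟩ := Y.isTree.connected.exists_adj_dist_add_one hne
  have h2 := SimpleGraph.dist_eq_one_iff_adj.2 hadj
  have hy := stab_eq_of_stab_le hX hell h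
  have hle : Y.stab y ≤ Y.stab y₁ := fun γ hγ =>
    smul_eq_of_btw hγ (h' (hy ▸ hγ)) (by omega)
  obtain ⟨g, rfl⟩ := hY.exists_smul_eq hadj hle
  have hgx : x = X.smul g x := hX.eq_of_stab_le fun γ hγ => by
    rw [mem_stab_smul, ← hy, ← mem_stab_smul]
    exact hle (h hγ)
  have hg : Y.smul g y = y := h hgx.symm
  rw [hg] at hadj
  exact hadj.ne rfl

lemma exists_stab_le_near {φ : X.V → Y.V} (L : ℝ)
    (hL : ∀ γ x, (Y.graph.dist (φ (X.smul γ x)) (Y.smul γ (φ x)) : ℝ) < L) (x : X.V) :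
    ∃ y, X.stab x ≤ Y.stab y ∧ Y.graph.dist y (φ x) ≤ ⌈L⌉₊ := by
  refine exists_fixed_of_bounded_orbit (X.stab x) (φ x) ⌈L⌉₊ fun γ hγ => ?_
  have h1 := hL γ x
  rw [mem_stab.1 hγ] at h1
  exact_mod_cast h1.le.trans (Nat.le_ceil L)

lemma exists_stab_le_of_quasiIsometry {φ : X.V → Y.V} (hφ : IsQuasiIsometry X Y φ) {L : ℝ}
    (hL : ∀ γ x, (Y.graph.dist (φ (X.smul γ x)) (Y.smul γ (φ x)) : ℝ) < L) (y : Y.V) :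
    ∃ x, Y.stab y ≤ X.stab x := by
  obtain ⟨K, C, hK, hC, hKC, hdense⟩ := hφ
  obtain ⟨x, hx⟩ := hdense y
  obtain ⟨p, hp, -⟩ := exists_fixed_of_bounded_orbit (Y.stab y) x ⌈K * (3 * C + L)⌉₊ fun γ hγ => by
    have h1 := Y.isTree.connected.dist_triangle (u := φ x) (v := y) (w := φ (X.smul γ x))
    have h2 := Y.isTree.connected.dist_triangle
      (u := y) (v := Y.smul γ (φ x)) (w := φ (X.smul γ x))
    have h3 := Y.dist_smul_smul γ y (φ x)
    rw [mem_stab.1 hγ, Y.graph.dist_comm (u := y) (v := φ x)] at h3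
    rw [h3] at h2
    have h4 := hL γ x
    rw [Y.graph.dist_comm] at h4
    have h5 := (hKC x (X.smul γ x)).1
    rify at h1 h2
    have h6 : K⁻¹ * (X.graph.dist x (X.smul γ x) : ℝ) ≤ 3 * C + L := by linarith
    rw [inv_mul_le_iff₀ (by linarith)] at h6
    exact_mod_cast h6.trans (Nat.le_ceil _)
  exact ⟨p, hp⟩

end GTree

open GTree in
/-- Theorem 7.4 (geometric rigidity): let `X` and `Y` be reduced cocompact
`G`-trees, with `X` strongly slide-free.  If `φ : X → Y` is a coarsely
equivariant quasi-isometry, then there is a unique equivariant isometry from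
`X` to `Y`, and it lies at finite distance from `φ`. -/
theorem geometric_rigidity {G : Type u} [Group G] (X Y : GTree G)
    (hXc : X.Cocompact) (hYc : Y.Cocompact)
    (hXr : X.Reduced) (hYr : Y.Reduced)
    (hssf : X.StronglySlideFree)
    (φ : X.V → Y.V)
    (hqi : IsQuasiIsometry X Y φ) (hce : CoarselyEquivariant X Y φ) :
    ∃ ψ : X.V → Y.V,
      (Function.Bijective ψ ∧
        (∀ x x' : X.V, Y.graph.dist (ψ x) (ψ x') = X.graph.dist x x') ∧
        (∀ (γ : G) (x : X.V), ψ (X.smul γ x) = Y.smul γ (ψ x))) ∧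
      (∀ ψ' : X.V → Y.V,
        (Function.Bijective ψ' ∧
          (∀ x x' : X.V, Y.graph.dist (ψ' x) (ψ' x') = X.graph.dist x x') ∧
          (∀ (γ : G) (x : X.V), ψ' (X.smul γ x) = Y.smul γ (ψ' x))) → ψ' = ψ) ∧
      ∃ D : ℝ, ∀ x : X.V, (Y.graph.dist (ψ x) (φ x) : ℝ) ≤ D := by
  obtain ⟨L, hL⟩ := hce
  choose ψ hψ hψd using exists_stab_le_near L hL
  have hell := exists_stab_le_of_quasiIsometry hqi hL
  have huniq : ∀ ψ' : X.V → Y.V, (∀ γ x, ψ' (X.smul γ x) = Y.smul γ (ψ' x)) → ψ' = ψ := by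
    intro ψ' h
    funext x
    refine eq_of_stab_le_stab hssf hYr hell (fun γ hγ => ?_) (hψ x)
    rw [mem_stab, ← h, mem_stab.1 hγ]
  have h : IsStabPreserving X Y ψ :=
    { ssf := hssf
      reduced := hYr
      elliptic := hell
      map_smul := fun γ x => by
        refine eq_of_stab_le_stab hssf hYr hell (hψ _) fun δ hδ => ?_
        rw [mem_stab_smul] at hδ ⊢
        exact hψ x hδ
      stab_map := fun x => stab_eq_of_stab_le hssf hell (hψ x) }
  exact ⟨ψ, ⟨⟨h.injective, h.surjective⟩, h.dist_map, h.map_smul⟩,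
    fun ψ' hψ' => huniq ψ' hψ'.2.2, _, fun x => Nat.cast_le.2 (hψd x)⟩
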